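/- arXiv:1107.4389 — 5 statements merged into one kernel-verified Lean document; each statement's English description precedes it below -/
import Mathlib

section
/- The function A(x) = sin(π·ln|x| / ln φ) is Golden periodic: for every nonzero real x, A(φx) = A(−x/φ), and consequently its Golden derivative D_F A(x) = (A(φx) − A(−x/φ))/(√5·x) vanishes for all x ≠ 0. -/
noncomputable def φ : ℝ := (1 + Real.sqrt 5) / 2

/-- The Golden periodic function A. -/
noncomputable def A (x : ℝ) : ℝ := Real.sin (Real.pi * Real.log |x| / Real.log φ)

theorem A_golden_periodic (x : ℝ) (hx : x ≠ 0) :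
    A (φ * x) = A (-x / φ) ∧ (A (φ * x) - A (-x / φ)) / (Real.sqrt 5 * x) = 0 := by
  have one_lt_φ : 1 < φ := by
    have h : Real.sqrt 1 < Real.sqrt 5 := Real.sqrt_lt_sqrt (by norm_num) (by norm_num)
    rw [Real.sqrt_one] at h
    unfold φ
    linarith
  have φ_pos : 0 < φ := by linarith
  have log_ne : Real.log φ ≠ 0 := (Real.log_pos one_lt_φ).ne'
  have abs_ne : |x| ≠ 0 := abs_ne_zero.mpr hx
  have h_mul : A (φ * x) = -A x := by
    unfold A
    rw [abs_mul, abs_of_pos φ_pos, Real.log_mul φ_pos.ne' abs_ne, ← Real.sin_add_pi]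
    congr 1
    field_simp
    ring
  have h_div : A (-x / φ) = -A x := by
    unfold A
    rw [abs_div, abs_neg, abs_of_pos φ_pos, Real.log_div abs_ne φ_pos.ne', ← Real.sin_sub_pi]
    congr 1
    field_simp
  rw [h_mul, h_div]
  simp
end

section
/- Let D : ℝ[X] → ℝ[X] be the unique linear operator on real polynomials with D(X^n) = F_n·X^{n−1} for n ≥ 1 and D(1) = 0 (the Golden derivative on polynomials). Then for every polynomial f of degree at most N, the Golden Taylor formula holds: f = ∑_{n=0}^N ((D^n f) evaluated at 0) · X^n / F_n!, where D^n denotes the n-fold iterate of D. -/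
open Polynomial

/-- The Fibonacci factorial `F_n! = F_1 ⋯ F_n`. -/
noncomputable def fibFact (n : ℕ) : ℝ := ∏ i ∈ Finset.range n, (Nat.fib (i + 1) : ℝ)

theorem fibFact_ne_zero (n : ℕ) : fibFact n ≠ 0 :=
  Finset.prod_ne_zero_iff.2 fun i _ => Nat.cast_ne_zero.2 (Nat.fib_pos.2 i.succ_pos).ne'

theorem fibFact_succ (n : ℕ) : fibFact (n + 1) = fibFact n * (Nat.fib (n + 1) : ℝ) :=
  Finset.prod_range_succ _ _

theorem golden_derivative_coeff
    (D : Polynomial ℝ →ₗ[ℝ] Polynomial ℝ)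
    (hD : ∀ n : ℕ, 1 ≤ n → D (X ^ n) = Polynomial.C (Nat.fib n : ℝ) * X ^ (n - 1))
    (hD1 : D 1 = 0) (f : Polynomial ℝ) (k : ℕ) :
    (D f).coeff k = (Nat.fib (k + 1) : ℝ) * f.coeff (k + 1) := by
  induction f using Polynomial.induction_on' with
  | add p q hp hq => rw [map_add, coeff_add, coeff_add, hp, hq, mul_add]
  | monomial n a =>
    rw [← C_mul_X_pow_eq_monomial, ← smul_eq_C_mul, map_smul]
    cases n with
    | zero => simp [hD1, coeff_one]
    | succ n =>
      rw [hD (n + 1) n.succ_pos, Nat.add_sub_cancel]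
      simp only [coeff_smul, coeff_C_mul, coeff_X_pow, smul_eq_mul, Nat.add_right_cancel_iff]
      split_ifs with h
      · subst h; ring
      · ring

theorem golden_derivative_pow_coeff
    (D : Polynomial ℝ →ₗ[ℝ] Polynomial ℝ)
    (hD : ∀ n : ℕ, 1 ≤ n → D (X ^ n) = Polynomial.C (Nat.fib n : ℝ) * X ^ (n - 1))
    (hD1 : D 1 = 0) (f : Polynomial ℝ) (n k : ℕ) :
    fibFact k * ((D ^ n) f).coeff k = fibFact (k + n) * f.coeff (k + n) := by
  induction n generalizing k with
  | zero => simp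
  | succ n ih =>
    rw [pow_succ', Module.End.mul_apply, golden_derivative_coeff D hD hD1, ← mul_assoc,
      ← fibFact_succ, ih, Nat.add_right_comm k 1 n, Nat.add_assoc k n 1]

theorem golden_taylor_formula
    (D : Polynomial ℝ →ₗ[ℝ] Polynomial ℝ)
    (hD : ∀ n : ℕ, 1 ≤ n → D (X ^ n) = Polynomial.C (Nat.fib n : ℝ) * X ^ (n - 1))
    (hD1 : D 1 = 0)
    (N : ℕ) (f : Polynomial ℝ) (hf : f.degree ≤ N) :
    f = ∑ n ∈ Finset.range (N + 1),
        Polynomial.C (((D ^ n) f).eval 0 / fibFact n) * X ^ n := by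
  have key : ∀ n, ((D ^ n) f).eval 0 / fibFact n = f.coeff n := fun n => by
    have h := golden_derivative_pow_coeff D hD hD1 f n 0
    rw [Nat.zero_add, fibFact, Finset.prod_range_zero, one_mul] at h
    rw [← coeff_zero_eq_eval_zero, h, mul_div_cancel_left₀ _ (fibFact_ne_zero n)]
  simp only [key]
  exact f.as_sum_range_C_mul_X_pow' (Nat.lt_succ_of_le (natDegree_le_of_degree_le hf))
end

section
/- Let B_n(x,y) = ∏_{k=0}^{n−1} (x + (−1)^k·φ^{n−1−2k}·y) be the Golden binomial. Then for every n ≥ 1, every real y, and every nonzero real x, the Golden derivative with respect to x satisfies (B_n(φx, y) − B_n(−x/φ, y))/(√5·x) = F_n · B_{n−1}(x, y). -/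
/-- The Golden binomial `(x+y)_F^n`. -/
noncomputable def goldenBinomial (n : ℕ) (x y : ℝ) : ℝ :=
  ∏ k ∈ Finset.range n, (x + (-1 : ℝ) ^ k * φ ^ ((n : ℤ) - 1 - 2 * k) * y)

lemma φ_eq_goldenRatio : φ = Real.goldenRatio := rfl

lemma φ_ne_zero : φ ≠ 0 := Real.goldenRatio_ne_zero

lemma goldenBinomial_succ_φ_mul (m : ℕ) (x y : ℝ) :
    goldenBinomial (m + 1) (φ * x) y =
      (φ ^ (m + 1) * x + (-1) ^ m * y) * goldenBinomial m x y := by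
  have hφ := φ_ne_zero
  have factor (k : ℕ) : φ * x + (-1) ^ k * φ ^ (((m + 1 : ℕ) : ℤ) - 1 - 2 * k) * y =
      φ * (x + (-1) ^ k * φ ^ ((m : ℤ) - 1 - 2 * k) * y) := by
    rw [show ((m + 1 : ℕ) : ℤ) - 1 - 2 * k = ((m : ℤ) - 1 - 2 * k) + 1 by push_cast; ring,
      zpow_add_one₀ hφ]
    ring
  have last : φ ^ (m + 1) * φ ^ ((m : ℤ) - 1 - 2 * m) = 1 := by
    rw [← zpow_natCast, ← zpow_add₀ hφ,
      show ((m + 1 : ℕ) : ℤ) + ((m : ℤ) - 1 - 2 * m) = 0 by push_cast; ring, zpow_zero]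
  simp only [goldenBinomial, factor]
  rw [Finset.prod_mul_distrib, Finset.prod_const, Finset.card_range, Finset.prod_range_succ]
  linear_combination (-1) ^ m * y *
    (∏ k ∈ Finset.range m, (x + (-1 : ℝ) ^ k * φ ^ ((m : ℤ) - 1 - 2 * k) * y)) * last

lemma goldenBinomial_succ_goldenConj_mul (m : ℕ) (x y : ℝ) :
    goldenBinomial (m + 1) (Real.goldenConj * x) y =
      (Real.goldenConj ^ (m + 1) * x + (-1) ^ m * y) * goldenBinomial m x y := by
  have hφ := φ_ne_zero
  have hmul : φ * Real.goldenConj = -1 := Real.goldenRatio_mul_goldenConj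
  have factor (k : ℕ) :
      Real.goldenConj * x +
          (-1) ^ (k + 1) * φ ^ (((m + 1 : ℕ) : ℤ) - 1 - 2 * ((k + 1 : ℕ) : ℤ)) * y =
        Real.goldenConj * (x + (-1) ^ k * φ ^ ((m : ℤ) - 1 - 2 * k) * y) := by
    rw [show (m : ℤ) - 1 - 2 * k =
        (((m + 1 : ℕ) : ℤ) - 1 - 2 * ((k + 1 : ℕ) : ℤ)) + 1 by push_cast; ring,
      zpow_add_one₀ hφ]
    linear_combination
      -(-1) ^ k * φ ^ (((m + 1 : ℕ) : ℤ) - 1 - 2 * ((k + 1 : ℕ) : ℤ)) * y * hmul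
  have first : Real.goldenConj ^ m * φ ^ m = (-1) ^ m := by
    rw [← mul_pow, mul_comm, hmul]
  rw [goldenBinomial, Finset.prod_range_succ']
  simp only [factor]
  rw [Finset.prod_mul_distrib, Finset.prod_const, Finset.card_range,
    show ((m + 1 : ℕ) : ℤ) - 1 - 2 * ((0 : ℕ) : ℤ) = (m : ℤ) by push_cast; ring, zpow_natCast,
    ← goldenBinomial]
  linear_combination y * goldenBinomial m x y * first

theorem golden_derivative_goldenBinomial (n : ℕ) (hn : 1 ≤ n) (y : ℝ) (x : ℝ) (hx : x ≠ 0) :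
    (goldenBinomial n (φ * x) y - goldenBinomial n (-x / φ) y) / (Real.sqrt 5 * x) =
      (Nat.fib n : ℝ) * goldenBinomial (n - 1) x y := by
  obtain ⟨m, rfl⟩ := Nat.exists_eq_add_of_le' hn
  have hconj : -x / φ = Real.goldenConj * x := by
    rw [div_eq_mul_inv, φ_eq_goldenRatio, Real.inv_goldenRatio]
    ring
  rw [hconj, goldenBinomial_succ_φ_mul, goldenBinomial_succ_goldenConj_mul, Real.coe_fib_eq,
    Nat.add_sub_cancel, φ_eq_goldenRatio]
  field_simp
  ring
end

section
/- For every real number y, the sequence a_n = ∏_{k=0}^{n−1} (1 + (−1)^k·φ^{−(2k+1)}·y), which equals the Golden binomial (1 + y/φ^n)_F^n, converges as n → ∞, and its limit equals the Jackson q-exponential with base q = −φ² evaluated at y/√5: lim_{n→∞} a_n = ∑_{k=0}^∞ (y/√5)^k / ([1]_q·[2]_q⋯[k]_q), where [j]_q = (q^j − 1)/(q − 1) with q = −φ², and this series converges absolutely. -/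
/-- The q-number `[j]_q = (q^j - 1)/(q - 1)`. -/
noncomputable def qNum (q : ℝ) (j : ℕ) : ℝ := (q ^ j - 1) / (q - 1)

/-- The q-factorial `[k]_q! = [1]_q ⋯ [k]_q`. -/
noncomputable def qFact (q : ℝ) (k : ℕ) : ℝ := ∏ j ∈ Finset.range k, qNum q (j + 1)

open Filter Topology

lemma qFact_succ (q : ℝ) (k : ℕ) : qFact q (k + 1) = qFact q k * qNum q (k + 1) :=
  Finset.prod_range_succ _ _

lemma pow_succ_ne_one_of_one_lt_abs {q : ℝ} (hq : 1 < |q|) (k : ℕ) : q ^ (k + 1) ≠ 1 := by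
  intro h
  have h1 : 1 < |q| ^ (k + 1) := one_lt_pow₀ hq k.succ_ne_zero
  rw [← abs_pow, h, abs_one] at h1
  exact lt_irrefl _ h1

lemma ne_one_of_one_lt_abs {q : ℝ} (hq : 1 < |q|) : q ≠ 1 := by
  simpa using pow_succ_ne_one_of_one_lt_abs hq 0

lemma qNum_succ_ne_zero {q : ℝ} (hq : 1 < |q|) (k : ℕ) : qNum q (k + 1) ≠ 0 :=
  div_ne_zero (sub_ne_zero.2 (pow_succ_ne_one_of_one_lt_abs hq k))
    (sub_ne_zero.2 (ne_one_of_one_lt_abs hq))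

lemma qFact_ne_zero {q : ℝ} (hq : 1 < |q|) (k : ℕ) : qFact q k ≠ 0 :=
  Finset.prod_ne_zero_iff.2 fun j _ => qNum_succ_ne_zero hq j

lemma tendsto_abs_qNum_atTop {q : ℝ} (hq : 1 < |q|) :
    Tendsto (fun k => |qNum q k|) atTop atTop := by
  have h0 : 0 < |q - 1| := abs_pos.2 (sub_ne_zero.2 (ne_one_of_one_lt_abs hq))
  refine tendsto_atTop_mono (f := fun k => (|q| ^ k - 1) / |q - 1|) (fun k => ?_) ?_
  · rw [qNum, abs_div]
    gcongr
    simpa [abs_pow] using abs_sub_abs_le_abs_sub (q ^ k) 1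
  · exact (tendsto_atTop_add_const_right _ (-1) (tendsto_pow_atTop_atTop_of_one_lt hq)).atTop_div_const
      h0

lemma summable_abs_qExp {q : ℝ} (hq : 1 < |q|) (t : ℝ) :
    Summable fun k : ℕ => |t ^ k / qFact q k| := by
  refine summable_of_ratio_norm_eventually_le (r := 1 / 2) (by norm_num) ?_
  have h := (tendsto_add_atTop_iff_nat 1).2 (tendsto_abs_qNum_atTop hq)
  filter_upwards [h.eventually_ge_atTop (2 * |t|)] with k hk
  have h1 : 0 < |qNum q (k + 1)| := abs_pos.2 (qNum_succ_ne_zero hq k)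
  have h2 : |t| / |qNum q (k + 1)| ≤ 1 / 2 := by
    rw [div_le_iff₀ h1]; linarith
  have h3 : t ^ (k + 1) / qFact q (k + 1) = t / qNum q (k + 1) * (t ^ k / qFact q k) := by
    rw [qFact_succ, pow_succ, mul_comm (t ^ k), mul_comm (qFact q k), mul_div_mul_comm]
  simp only [Real.norm_eq_abs, abs_abs]
  rw [h3, abs_mul, abs_div t]
  gcongr

lemma qExp_mul_base {q : ℝ} (hq : 1 < |q|) (t : ℝ) :
    ∑' k : ℕ, (q * t) ^ k / qFact q k = (1 + (q - 1) * t) * ∑' k : ℕ, t ^ k / qFact q k := by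
  have hs (s : ℝ) : Summable fun k : ℕ => s ^ k / qFact q k := (summable_abs_qExp hq s).of_abs
  have key (k : ℕ) : (q * t) ^ (k + 1) / qFact q (k + 1)
      = t ^ (k + 1) / qFact q (k + 1) + (q - 1) * t * (t ^ k / qFact q k) := by
    have h1 := qFact_ne_zero hq k
    have h2 := sub_ne_zero.2 (ne_one_of_one_lt_abs hq)
    have h3 := sub_ne_zero.2 (pow_succ_ne_one_of_one_lt_abs hq k)
    rw [qFact_succ, qNum]
    field_simp
    ring
  rw [(hs (q * t)).tsum_eq_zero_add, tsum_congr key,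
    ((summable_nat_add_iff 1).2 (hs t)).tsum_add ((hs t).mul_left _), tsum_mul_left, ← add_assoc,
    add_mul, one_mul]
  congr 1
  rw [(hs t).tsum_eq_zero_add]
  simp

lemma qExp_eq_prod_mul {q : ℝ} (hq : 1 < |q|) (t : ℝ) (n : ℕ) :
    ∑' k : ℕ, t ^ k / qFact q k
      = (∏ k ∈ Finset.range n, (1 + (q - 1) * (t * q⁻¹ ^ (k + 1)))) *
        ∑' k : ℕ, (t * q⁻¹ ^ n) ^ k / qFact q k := by
  have hq0 : q ≠ 0 := abs_pos.1 (one_pos.trans hq)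
  induction n with
  | zero => simp
  | succ n ih =>
    have h : t * q⁻¹ ^ n = q * (t * q⁻¹ ^ (n + 1)) := by
      rw [pow_succ, mul_left_comm, mul_left_comm q, mul_inv_cancel₀ hq0, mul_one]
    rw [ih, Finset.prod_range_succ, h, qExp_mul_base hq, mul_assoc]

lemma tendsto_qExp_geometric {q : ℝ} (hq : 1 < |q|) (t : ℝ) :
    Tendsto (fun n : ℕ => ∑' k : ℕ, (t * q⁻¹ ^ n) ^ k / qFact q k) atTop (𝓝 1) := by
  have hq1 : |q⁻¹| < 1 := by rw [abs_inv]; exact inv_lt_one_of_one_lt₀ hq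
  have hlim : ∑' k : ℕ, (0 : ℝ) ^ k / qFact q k = 1 := by
    rw [tsum_eq_single 0 fun k hk => by simp [hk]]
    simp [qFact]
  have h0 : Tendsto (fun n : ℕ => t * q⁻¹ ^ n) atTop (𝓝 0) := by
    simpa using (tendsto_pow_atTop_nhds_zero_of_abs_lt_one hq1).const_mul t
  rw [← hlim]
  refine tendsto_tsum_of_dominated_convergence (summable_abs_qExp hq t)
    (fun k => (h0.pow k).div_const _) (Eventually.of_forall fun n k => ?_)
  rw [Real.norm_eq_abs, abs_div, abs_div, abs_pow, abs_pow, abs_mul, abs_pow]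
  gcongr
  exact mul_le_of_le_one_right (abs_nonneg _) (pow_le_one₀ (abs_nonneg _) hq1.le)

/-- Euler's product for the Jackson `q`-exponential with `|q| > 1`. -/
lemma tendsto_prod_qExp {q : ℝ} (hq : 1 < |q|) (t : ℝ) :
    Tendsto (fun n : ℕ => ∏ k ∈ Finset.range n, (1 + (q - 1) * (t * q⁻¹ ^ (k + 1)))) atTop
      (𝓝 (∑' k : ℕ, t ^ k / qFact q k)) := by
  have h := tendsto_qExp_geometric hq t
  have h' := (tendsto_const_nhds (x := ∑' k : ℕ, t ^ k / qFact q k)).div h one_ne_zero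
  rw [div_one] at h'
  refine h'.congr' ?_
  filter_upwards [h.eventually_ne one_ne_zero] with n hn
  rw [Pi.div_apply, qExp_eq_prod_mul hq t n, mul_div_cancel_right₀ _ hn]

theorem golden_binomial_limit (y : ℝ) :
    (Summable fun k : ℕ => |(y / Real.sqrt 5) ^ k / qFact (-φ ^ 2) k|) ∧
    Filter.Tendsto
      (fun n : ℕ => ∏ k ∈ Finset.range n, (1 + (-1 : ℝ) ^ k * φ ^ (-(2 * (k : ℤ) + 1)) * y))
      Filter.atTop
      (nhds (∑' k : ℕ, (y / Real.sqrt 5) ^ k / qFact (-φ ^ 2) k)) := by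
  have h5 : Real.sqrt 5 ^ 2 = 5 := Real.sq_sqrt (by norm_num)
  have h51 : 1 < Real.sqrt 5 := Real.lt_sqrt_of_sq_lt (by norm_num)
  have hφ1 : 1 < φ := by unfold φ; linarith
  have hφ0 : φ ≠ 0 := by positivity
  have hφ : φ ^ 2 + 1 = Real.sqrt 5 * φ := by unfold φ; linear_combination (-1 / 4) * h5
  have hq : 1 < |-φ ^ 2| := by
    rw [abs_neg, abs_of_nonneg (sq_nonneg φ)]
    exact one_lt_pow₀ hφ1 two_ne_zero
  refine ⟨summable_abs_qExp hq _, (tendsto_prod_qExp hq _).congr fun n => ?_⟩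
  refine Finset.prod_congr rfl fun k _ => ?_
  have hz : φ ^ (-(2 * (k : ℤ) + 1)) = (φ ^ (2 * k + 1))⁻¹ := by
    rw [zpow_neg]; norm_cast
  have hp : (-φ ^ 2)⁻¹ ^ (k + 1) = -((-1) ^ k * (φ ^ (2 * k + 1))⁻¹ * φ⁻¹) := by
    rw [inv_neg, neg_pow, inv_pow, ← pow_mul]
    field_simp
    ring
  have hq1 : -φ ^ 2 - 1 = -(Real.sqrt 5 * φ) := by rw [← hφ]; ring
  rw [hz, hp, hq1]
  field_simp
end

section
/- On the space V = ℕ →₀ ℝ of finitely supported real sequences with standard basis (e_n), define linear operators b⁺(e_n) = √(F_{n+1})·e_{n+1}, b(e_n) = √(F_n)·e_{n−1} (with b(e_0) = 0), and N(e_n) = n·e_n. Then these operators realize the Golden oscillator algebra: (i) b⁺∘b = [N]_F and b∘b⁺ = [N+1]_F, where [N]_F(e_n) = F_n·e_n and [N+1]_F(e_n) = F_{n+1}·e_n; (ii) b∘b⁺ − φ·(b⁺∘b) = (−1/φ)^N, where (−1/φ)^N(e_n) = (−1/φ)^n·e_n; (iii) b∘b⁺ + (1/φ)·(b⁺∘b)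 = φ^N, where φ^N(e_n) = φ^n·e_n; and (iv) N∘b⁺ − b⁺∘N = b⁺ and N∘b − b∘N = −b. -/
/-- Creation operator: `b⁺ e_n = √(F_{n+1}) e_{n+1}`. -/
noncomputable def bplus : (ℕ →₀ ℝ) →ₗ[ℝ] (ℕ →₀ ℝ) :=
  Finsupp.lsum ℝ fun n => Real.sqrt (Nat.fib (n + 1)) • Finsupp.lsingle (n + 1)

/-- Annihilation operator: `b e_n = √(F_n) e_{n-1}` (so `b e_0 = 0` since `F_0 = 0`). -/
noncomputable def bminus : (ℕ →₀ ℝ) →ₗ[ℝ] (ℕ →₀ ℝ) :=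
  Finsupp.lsum ℝ fun n => Real.sqrt (Nat.fib n) • Finsupp.lsingle (n - 1)

/-- Number operator: `N e_n = n e_n`. -/
noncomputable def Nop : (ℕ →₀ ℝ) →ₗ[ℝ] (ℕ →₀ ℝ) :=
  Finsupp.lsum ℝ fun n => (n : ℝ) • Finsupp.lsingle n

/-- Fibonacci number operator: `[N]_F e_n = F_n e_n`. -/
noncomputable def fibNop : (ℕ →₀ ℝ) →ₗ[ℝ] (ℕ →₀ ℝ) :=
  Finsupp.lsum ℝ fun n => (Nat.fib n : ℝ) • Finsupp.lsingle n

/-- Shifted Fibonacci number operator: `[N+1]_F e_n = F_{n+1} e_n`. -/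
noncomputable def fibNopSucc : (ℕ →₀ ℝ) →ₗ[ℝ] (ℕ →₀ ℝ) :=
  Finsupp.lsum ℝ fun n => (Nat.fib (n + 1) : ℝ) • Finsupp.lsingle n

/-- Operator `(-1/φ)^N : e_n ↦ (-1/φ)^n e_n`. -/
noncomputable def conjPowNop : (ℕ →₀ ℝ) →ₗ[ℝ] (ℕ →₀ ℝ) :=
  Finsupp.lsum ℝ fun n => ((-1 / φ : ℝ) ^ n) • Finsupp.lsingle n

/-- Operator `φ^N : e_n ↦ φ^n e_n`. -/
noncomputable def goldenPowNop : (ℕ →₀ ℝ) →ₗ[ℝ] (ℕ →₀ ℝ) :=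
  Finsupp.lsum ℝ fun n => ((φ : ℝ) ^ n) • Finsupp.lsingle n

lemma bplus_single (n : ℕ) (a : ℝ) :
    bplus (Finsupp.single n a) = Finsupp.single (n + 1) (√(Nat.fib (n + 1)) * a) := by
  simp [bplus]

lemma bminus_single (n : ℕ) (a : ℝ) :
    bminus (Finsupp.single n a) = Finsupp.single (n - 1) (√(Nat.fib n) * a) := by
  simp [bminus]

lemma Nop_single (n : ℕ) (a : ℝ) :
    Nop (Finsupp.single n a) = Finsupp.single n (n * a) := by
  simp [Nop]

lemma bplus_comp_bminus : bplus ∘ₗ bminus = fibNop := by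
  refine Finsupp.lhom_ext fun n a => ?_
  cases n with
  | zero => simp [bminus_single, fibNop]
  | succ n => simp [bminus_single, bplus_single, fibNop, -Finsupp.single_mul, ← mul_assoc]

lemma bminus_comp_bplus : bminus ∘ₗ bplus = fibNopSucc := by
  refine Finsupp.lhom_ext fun n a => ?_
  simp [bminus_single, bplus_single, fibNopSucc, -Finsupp.single_mul, ← mul_assoc]

lemma fibNopSucc_sub_smul_fibNop : fibNopSucc - φ • fibNop = conjPowNop := by
  refine Finsupp.lhom_ext fun n a => ?_
  have hψ : -1 / φ = Real.goldenConj := by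
    change -1 / Real.goldenRatio = _
    rw [neg_div, one_div, Real.inv_goldenRatio, neg_neg]
  have h : (Nat.fib (n + 1) : ℝ) - φ * Nat.fib n = Real.goldenConj ^ n :=
    Real.fib_succ_sub_goldenRatio_mul_fib n
  simp [fibNopSucc, fibNop, conjPowNop, hψ, ← Finsupp.single_sub, ← h, sub_mul, mul_assoc,
    -Finsupp.single_mul]

lemma fibNopSucc_add_smul_fibNop : fibNopSucc + (1 / φ) • fibNop = goldenPowNop := by
  refine Finsupp.lhom_ext fun n a => ?_
  have hψ : φ⁻¹ = -Real.goldenConj := Real.inv_goldenRatio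
  have h : (Nat.fib (n + 1) : ℝ) - Real.goldenConj * Nat.fib n = φ ^ n :=
    Real.fib_succ_sub_goldenConj_mul_fib n
  simp [fibNopSucc, fibNop, goldenPowNop, hψ, ← Finsupp.single_add, ← h, add_mul, mul_assoc,
    sub_eq_add_neg, -Finsupp.single_mul, ← Finsupp.single_neg]

lemma Nop_bplus_commutator : Nop ∘ₗ bplus - bplus ∘ₗ Nop = bplus := by
  refine Finsupp.lhom_ext fun n a => ?_
  simp only [LinearMap.sub_apply, LinearMap.comp_apply, bplus_single, Nop_single,
    ← Finsupp.single_sub]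
  congr 1
  push_cast
  ring

lemma Nop_bminus_commutator : Nop ∘ₗ bminus - bminus ∘ₗ Nop = -bminus := by
  refine Finsupp.lhom_ext fun n a => ?_
  cases n with
  | zero => simp [bminus_single, Nop_single]
  | succ n =>
    simp only [LinearMap.sub_apply, LinearMap.neg_apply, LinearMap.comp_apply, bminus_single,
      Nop_single, Nat.add_sub_cancel, ← Finsupp.single_sub, ← Finsupp.single_neg]
    congr 1
    push_cast
    ring

theorem golden_oscillator_realization :
    (bplus ∘ₗ bminus = fibNop ∧ bminus ∘ₗ bplus = fibNopSucc) ∧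
    (bminus ∘ₗ bplus - φ • (bplus ∘ₗ bminus) = conjPowNop) ∧
    (bminus ∘ₗ bplus + (1 / φ) • (bplus ∘ₗ bminus) = goldenPowNop) ∧
    (Nop ∘ₗ bplus - bplus ∘ₗ Nop = bplus ∧ Nop ∘ₗ bminus - bminus ∘ₗ Nop = -bminus) := by
  rw [bplus_comp_bminus, bminus_comp_bplus]
  exact ⟨⟨rfl, rfl⟩, fibNopSucc_sub_smul_fibNop, fibNopSucc_add_smul_fibNop,
    Nop_bplus_commutator, Nop_bminus_commutator⟩
end
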